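/- (Corollary 1) For q ∈ {5, 11, 17, 23}, a permutation σ of the 2q+2 coordinate positions maps the code L(q) onto itself (i.e., permuting the coordinates of every codeword by σ yields a codeword) if and only if σ maps every block of the Hadamard 3-design D(q) onto a block of D(q). In other words, the full permutation automorphism group of L(q) coincides with the full automorphism group of D(q). -/

import Mathlib

open Matrix Finset

/-- The Pless matrix `S_q`, with rows and columns indexed by `GF(q) ∪ {∞}`
(`none` playing the role of `∞`), built from the quadratic character of `GF(q)`. -/
def Smat (F : Type) [Field F] [Fintype F] [DecidableEq F] :
    Matrix (Option F) (Option F) ℤ := fun i j =>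
  match i, j with
  | none, none => 0
  | none, some _ => 1
  | some _, none => quadraticChar F (-1)
  | some a, some b => quadraticChar F (a - b)

/-- The matrix `U_q`, obtained from `S_q` by replacing each entry `s_{a,∞}`
(`a ∈ GF(q)`) in the column labeled `∞` by `-1`. -/
def Umat (F : Type) [Field F] [Fintype F] [DecidableEq F] :
    Matrix (Option F) (Option F) ℤ := fun i j =>
  match i, j with
  | some _, none => -1
  | i, j => Smat F i j

/-- The row of the generator matrix `(I | U_q)` of the code `L(q)`,
reduced modulo 3, indexed by `i : Option F`. -/
def genRowL (F : Type) [Field F] [Fintype F] [DecidableEq F] (i : Option F) :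
    (Option F ⊕ Option F) → ZMod 3 := fun j =>
  match j with
  | Sum.inl k => if i = k then 1 else 0
  | Sum.inr k => ((Umat F i k : ℤ) : ZMod 3)

/-- The code `L(q)`: the ternary code of length `2q+2` spanned by the rows of
`(I | U_q)` reduced modulo 3; it is monomially equivalent to the Pless symmetry code. -/
def Lcode (F : Type) [Field F] [Fintype F] [DecidableEq F] :
    Submodule (ZMod 3) ((Option F ⊕ Option F) → ZMod 3) :=
  Submodule.span (ZMod 3) (Set.range (genRowL F))

/-- The Hadamard matrix `H = [[I − U_qᵀ, U_q + I], [I + U_qᵀ, U_q − I]]`. -/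
def Hmat (F : Type) [Field F] [Fintype F] [DecidableEq F] :
    Matrix (Option F ⊕ Option F) (Option F ⊕ Option F) ℤ :=
  Matrix.fromBlocks (1 - (Umat F)ᵀ) (Umat F + 1) (1 + (Umat F)ᵀ) (Umat F - 1)

/-- The vector `r + 2·1̄` over `GF(3)`, where `r` is the row of `H` (if `s = true`)
or of `−H` (if `s = false`) indexed by `i`, reduced modulo 3. -/
def dvec (F : Type) [Field F] [Fintype F] [DecidableEq F]
    (s : Bool) (i : Option F ⊕ Option F) : (Option F ⊕ Option F) → ZMod 3 := fun j =>
  (if s then 1 else -1) * ((Hmat F i j : ℤ) : ZMod 3) + 2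

/-- A ternary digit, in a form on which the kernel computes quickly. -/
inductive Trit | zero | pos | neg

namespace Trit

/-- The element of `GF(3)` represented by a digit. -/
def val : Trit → ZMod 3
  | zero => 0
  | pos => 1
  | neg => -1

/-- Addition modulo 3. -/
def add : Trit → Trit → Trit
  | zero, b => b
  | pos, zero => pos
  | pos, pos => neg
  | pos, neg => zero
  | neg, zero => neg
  | neg, pos => zero
  | neg, neg => pos

/-- Negation modulo 3. -/
def opp : Trit → Trit
  | zero => zero
  | pos => neg
  | neg => pos

theorem val_add (a b : Trit) : (add a b).val = a.val + b.val := by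
  cases a <;> cases b <;> decide

theorem val_opp (a : Trit) : a.opp.val = -a.val := by
  cases a <;> decide

/-- `force a k` is `k a`, but evaluates `a` first. -/
def force {β : Type} (a : Trit) (k : Trit → β) : β :=
  match a with
  | zero => k zero
  | pos => k pos
  | neg => k neg

theorem force_eq {β : Type} (a : Trit) (k : Trit → β) : a.force k = k a := by
  cases a <;> rfl

/-- The signed digit `-a` or `a`, according to whether the bit is set. -/
def signed (b : Bool) (a : Trit) : Trit := if b then a.opp else a

/-- Evaluates a list of digits before passing it on. -/
def forceList {β : Type} : List Trit → (List Trit → β) → β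
  | [], k => k []
  | a :: l, k => forceList l fun l' => a.force fun a' => k (a' :: l')

theorem forceList_eq {β : Type} (l : List Trit) (k : List Trit → β) :
    forceList l k = k l := by
  induction l generalizing k with
  | nil => rfl
  | cons a l ih => simp [forceList, ih, force_eq]

/-- Evaluates a list of lists of digits before passing it on. -/
def forceLists {β : Type} : List (List Trit) → (List (List Trit) → β) → β
  | [], k => k []
  | a :: l, k => forceLists l fun l' => forceList a fun a' => k (a' :: l')

theorem forceLists_eq {β : Type} (l : List (List Trit)) (k : List (List Trit) → β) :
    forceLists l k = k l := by
  induction l generalizing k with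
  | nil => rfl
  | cons a l ih => simp [forceLists, ih, forceList_eq]

end Trit

/-- `natForce n k` is `k n`, but evaluates `n` first. -/
def natForce {β : Type} (n : ℕ) (k : ℕ → β) : β :=
  match n with
  | 0 => k 0
  | m + 1 => k (m + 1)

theorem natForce_eq {β : Type} (n : ℕ) (k : ℕ → β) : natForce n k = k n := by
  cases n <;> rfl

/-- Evaluates a list of natural numbers before passing it on. -/
def natForceList {β : Type} : List ℕ → (List ℕ → β) → β
  | [], k => k []
  | a :: l, k => natForceList l fun l' => natForce a fun a' => k (a' :: l')

theorem natForceList_eq {β : Type} (l : List ℕ) (k : List ℕ → β) :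
    natForceList l k = k l := by
  induction l generalizing k with
  | nil => rfl
  | cons a l ih => simp [natForceList, ih, natForce_eq]

/-- The number with the given binary digits, most significant first, preceded by those of `X`. -/
def bitIndexFrom (X : ℕ) : List Bool → ℕ
  | [] => X
  | b :: bs => bitIndexFrom (2 * X + b.toNat) bs

/-- The number with the given binary digits, most significant first. -/
def bitIndex (bs : List Bool) : ℕ := bitIndexFrom 0 bs

theorem bitIndexFrom_eq (X : ℕ) (bs : List Bool) :
    bitIndexFrom X bs = X * 2 ^ bs.length + bitIndex bs := by
  induction bs generalizing X with
  | nil => simp [bitIndexFrom, bitIndex]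
  | cons b bs ih =>
    rw [bitIndex, bitIndexFrom, bitIndexFrom, ih, ih (2 * 0 + _), List.length_cons]
    ring

theorem bitIndex_cons (b : Bool) (bs : List Bool) :
    bitIndex (b :: bs) = b.toNat * 2 ^ bs.length + bitIndex bs := by
  rw [bitIndex, bitIndexFrom, bitIndexFrom_eq]
  simp

theorem bitIndex_lt (bs : List Bool) : bitIndex bs < 2 ^ bs.length := by
  induction bs with
  | nil => simp [bitIndex, bitIndexFrom]
  | cons b bs ih =>
    rw [bitIndex_cons, List.length_cons, pow_succ]
    have := Bool.toNat_le b
    nlinarith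

theorem bitIndex_injective {as bs : List Bool} (hl : as.length = bs.length)
    (h : bitIndex as = bitIndex bs) : as = bs := by
  induction as generalizing bs with
  | nil => simpa [eq_comm] using hl
  | cons a as ih =>
    cases bs with
    | nil => simp at hl
    | cons b bs =>
      have hl' : as.length = bs.length := by simpa using hl
      rw [bitIndex_cons, bitIndex_cons, hl'] at h
      have h1 := bitIndex_lt as
      have h2 := bitIndex_lt bs
      rw [hl'] at h1
      cases a <;> cases b <;> simp at h ⊢
      · exact ih hl' h
      · omega
      · omega
      · exact ih hl' h

/-- The signed sum of the digits `us`, with signs given by the bits `bs`. -/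
def signedSum : List Trit → List Bool → ZMod 3
  | u :: us, b :: bs => (Trit.signed b u).val + signedSum us bs
  | _, _ => 0

/-- Three truth tables: for a `GF(3)`-valued function of a bit list `bs`, the `bitIndex bs`-th bits
record whether the value differs from `0`, from `1` and from `-1`. -/
structure TruthTable where
  (z p m : ℕ)

namespace TruthTable

/-- Evaluates a truth table before passing it on. -/
def force {β : Type} (t : TruthTable) (k : TruthTable → β) : β :=
  natForce t.z fun z => natForce t.p fun p => natForce t.m fun m => k ⟨z, p, m⟩

theorem force_eq {β : Type} (t : TruthTable) (k : TruthTable → β) : t.force k = k t := by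
  simp [force, natForce_eq]

/-- Adds the term with coefficient `u` and a new leading sign bit to a function of
bit lists whose number is `s`. -/
def step (u : Trit) (s : ℕ) (t : TruthTable) : TruthTable :=
  match u with
  | .zero => ⟨t.z ||| t.z <<< s, t.p ||| t.p <<< s, t.m ||| t.m <<< s⟩
  | .pos => ⟨t.m ||| t.p <<< s, t.z ||| t.m <<< s, t.p ||| t.z <<< s⟩
  | .neg => ⟨t.p ||| t.m <<< s, t.m ||| t.z <<< s, t.z ||| t.p <<< s⟩

/-- The truth tables of `signedSum us`. -/
def ofList : List Trit → TruthTable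
  | [] => ⟨0, 1, 1⟩
  | u :: us => step u (2 ^ us.length) (ofList us)

/-- `ofList` with forced evaluation. -/
def withOfList {β : Type} : List Trit → (TruthTable → β) → β
  | [], k => k ⟨0, 1, 1⟩
  | u :: us, k => withOfList us fun t => (step u (2 ^ us.length) t).force k

theorem withOfList_eq {β : Type} (us : List Trit) (k : TruthTable → β) :
    withOfList us k = k (ofList us) := by
  induction us generalizing k with
  | nil => rfl
  | cons u us ih => simp [withOfList, ih, force_eq, ofList]

/-- The list of truth tables of given lists of digits, with forced evaluation. -/
def withOfLists {β : Type} : List (List Trit) → (List TruthTable → β) → β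
  | [], k => k []
  | us :: l, k => withOfLists l fun ts => withOfList us fun t => k (t :: ts)

theorem withOfLists_eq {β : Type} (l : List (List Trit)) (k : List TruthTable → β) :
    withOfLists l k = k (l.map ofList) := by
  induction l generalizing k with
  | nil => rfl
  | cons us l ih => simp [withOfLists, ih, withOfList_eq]

theorem testBit_or_shift {A B s : ℕ} (hA : A < 2 ^ s) (b : Bool) {i : ℕ} (hi : i < s) :
    (A ||| B <<< s).testBit (b.toNat * s + i) = if b then B.testBit i else A.testBit i := by
  cases b
  · simp [Nat.testBit_or, Nat.testBit_shiftLeft, hi]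
  · have : A.testBit (s + i) = false :=
      Nat.testBit_lt_two_pow (hA.trans_le (Nat.pow_le_pow_right (by norm_num) (by omega)))
    simp [Nat.testBit_or, Nat.testBit_shiftLeft, this]

theorem or_shift_lt {A B s : ℕ} (hA : A < 2 ^ s) (hB : B < 2 ^ s) :
    A ||| B <<< s < 2 ^ (2 * s) := by
  apply Nat.or_lt_two_pow
  · exact hA.trans_le (Nat.pow_le_pow_right (by norm_num) (by omega))
  · rw [Nat.shiftLeft_eq, two_mul, pow_add]
    exact Nat.mul_lt_mul_of_pos_right hB (by positivity)

theorem ofList_lt (us : List Trit) :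
    (ofList us).z < 2 ^ 2 ^ us.length ∧ (ofList us).p < 2 ^ 2 ^ us.length ∧
      (ofList us).m < 2 ^ 2 ^ us.length := by
  induction us with
  | nil => simp [ofList]
  | cons u us ih =>
    obtain ⟨hz, hp, hm⟩ := ih
    rw [List.length_cons, pow_succ', ofList]
    cases u <;> exact ⟨or_shift_lt ‹_› ‹_›, or_shift_lt ‹_› ‹_›, or_shift_lt ‹_› ‹_›⟩

theorem testBit_ofList (us : List Trit) (bs : List Bool) (h : us.length = bs.length) :
    (ofList us).z.testBit (bitIndex bs) = decide (signedSum us bs ≠ 0) ∧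
      (ofList us).p.testBit (bitIndex bs) = decide (signedSum us bs ≠ 1) ∧
      (ofList us).m.testBit (bitIndex bs) = decide (signedSum us bs ≠ -1) := by
  induction us generalizing bs with
  | nil =>
    cases bs with
    | nil => simp [ofList, signedSum, bitIndex, bitIndexFrom]
    | cons => simp at h
  | cons u us ih =>
    cases bs with
    | nil => simp at h
    | cons b bs =>
      have hl : us.length = bs.length := by simpa using h
      obtain ⟨hz, hp, hm⟩ := ofList_lt us
      obtain ⟨iz, ip, im⟩ := ih bs hl
      have hi := bitIndex_lt bs
      rw [← hl] at hi
      rw [bitIndex_cons, ← hl, ofList, signedSum]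
      generalize signedSum us bs = y at *
      cases u <;> simp only [step] <;>
        refine ⟨(testBit_or_shift ‹_› b hi).trans ?_, (testBit_or_shift ‹_› b hi).trans ?_,
          (testBit_or_shift ‹_› b hi).trans ?_⟩ <;>
        simp only [iz, ip, im] <;> clear iz ip im hz hp hm hi ih h <;> revert y b <;> decide

/-- The truth table recording whether the function, increased by `o`, differs from `0`. -/
def neZero (t : TruthTable) : Trit → ℕ
  | .zero => t.z
  | .pos => t.m
  | .neg => t.p

/-- The truth table recording whether the function, increased by `o`, differs from `1`. -/
def neOne (t : TruthTable) : Trit → ℕ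
  | .zero => t.p
  | .pos => t.z
  | .neg => t.m

theorem testBit_neZero (us : List Trit) (bs : List Bool) (h : us.length = bs.length) (o : Trit) :
    ((ofList us).neZero o).testBit (bitIndex bs) = decide (o.val + signedSum us bs ≠ 0) := by
  obtain ⟨hz, hp, hm⟩ := testBit_ofList us bs h
  generalize signedSum us bs = y at *
  cases o <;> simp only [neZero, hz, hp, hm] <;> clear hz hp hm <;> revert y <;> decide

theorem testBit_neOne (us : List Trit) (bs : List Bool) (h : us.length = bs.length) (o : Trit) :
    ((ofList us).neOne o).testBit (bitIndex bs) = decide (o.val + signedSum us bs ≠ 1) := by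
  obtain ⟨hz, hp, hm⟩ := testBit_ofList us bs h
  generalize signedSum us bs = y at *
  cases o <;> simp only [neOne, hz, hp, hm] <;> clear hz hp hm <;> revert y <;> decide

/-- Intersects `S` with the sets where the functions with tables `ts`, increased by `os`,
do not vanish, and passes the result to `k` unless it is empty. -/
def nonvanishing : List Trit → List TruthTable → ℕ → (ℕ → Bool) → Bool
  | o :: os, t :: ts, S, k =>
    match S &&& t.neZero o with
    | 0 => true
    | S' + 1 => nonvanishing os ts (S' + 1) k
  | _, _, S, k => k S

/-- The parity of the number of functions with tables `ts` which, increased by `os`,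
differ from `1`. -/
def parity : List Trit → List TruthTable → ℕ
  | o :: os, t :: ts => t.neOne o ^^^ parity os ts
  | _, _ => 0

variable {κ : Type}

theorem exists_of_nonvanishing {js : List κ} {o : κ → Trit} {c : κ → List Trit} {S : ℕ}
    {k : ℕ → Bool} (h : nonvanishing (js.map o) (js.map fun j => ofList (c j)) S k = true)
    {bs : List Bool} (hl : ∀ j ∈ js, (c j).length = bs.length)
    (hne : ∀ j ∈ js, (o j).val + signedSum (c j) bs ≠ 0) (hS : S.testBit (bitIndex bs) = true) :
    ∃ S', S'.testBit (bitIndex bs) = true ∧ k S' = true := by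
  induction js generalizing S with
  | nil => exact ⟨S, hS, h⟩
  | cons j js ih =>
    have hb : (S &&& (ofList (c j)).neZero (o j)).testBit (bitIndex bs) = true := by
      rw [Nat.testBit_and, hS, testBit_neZero _ _ (hl j (by simp))]
      simpa using hne j (by simp)
    rw [List.map_cons, List.map_cons, nonvanishing] at h
    split at h
    · next h0 => simp [h0] at hb
    · next S' h1 =>
      rw [h1] at hb
      exact ih h (fun j hj => hl j (by simp [hj])) (fun j hj => hne j (by simp [hj])) hb

theorem prod_eq_of_parity {js : List κ} {o : κ → Trit} {c : κ → List Trit} {bs : List Bool}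
    (hl : ∀ j ∈ js, (c j).length = bs.length)
    (hne : ∀ j ∈ js, (o j).val + signedSum (c j) bs ≠ 0) :
    (js.map fun j => (o j).val + signedSum (c j) bs).prod =
      if (parity (js.map o) (js.map fun j => ofList (c j))).testBit (bitIndex bs)
        then -1 else 1 := by
  induction js with
  | nil => simp [parity]
  | cons j js ih =>
    have h1 := testBit_neOne _ _ (hl j (by simp)) (o j)
    have h2 := hne j (by simp)
    rw [List.map_cons, List.map_cons, List.map_cons, List.prod_cons, parity, Nat.testBit_xor, h1,
      ih (fun j hj => hl j (by simp [hj])) (fun j hj => hne j (by simp [hj]))]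
    generalize (o j).val + signedSum (c j) bs = y at *
    generalize Nat.testBit _ _ = b at *
    clear h1 ih
    revert y b
    decide

/-- The set of the numbers `t < 2 ^ lo` such that `X * 2 ^ lo + t` occurs in `R`. -/
def slice (lo X : ℕ) : List ℕ → ℕ
  | [] => 0
  | r :: R =>
    match Nat.beq (r >>> lo) X with
    | true => 1 <<< (r % 2 ^ lo) ||| slice lo X R
    | false => slice lo X R

theorem mem_of_testBit_slice {lo X t : ℕ} {R : List ℕ}
    (h : (slice lo X R).testBit t = true) : X * 2 ^ lo + t ∈ R := by
  induction R with
  | nil => simp [slice] at h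
  | cons r R ih =>
    rw [slice] at h
    split at h
    · next hX =>
      rw [Nat.testBit_or, Bool.or_eq_true] at h
      rcases h with h | h
      · rw [Nat.one_shiftLeft, Nat.testBit_two_pow, decide_eq_true_iff] at h
        have := Nat.eq_of_beq_eq_true hX
        rw [Nat.shiftRight_eq_div_pow] at this
        rw [← h, ← this, mul_comm, Nat.div_add_mod]
        simp
      · exact List.mem_cons_of_mem _ (ih h)
    · exact List.mem_cons_of_mem _ (ih h)

/-- Checks that whenever the functions with tables `ts`, increased by `os`, do not vanish and have
product `1` at some `t`, then `X * 2 ^ lo + t` occurs in `R`. -/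
def checkLeaf (ts : List TruthTable) (lo : ℕ) (R : List ℕ) (os : List Trit) (X : ℕ) : Bool :=
  nonvanishing os ts (2 ^ 2 ^ lo - 1) fun S =>
    Nat.beq (S &&& (parity os ts ||| slice lo X R)) S

theorem mem_of_checkLeaf {js : List κ} {o : κ → Trit} {c : κ → List Trit} {lo X : ℕ} {R : List ℕ}
    (h : checkLeaf (js.map fun j => ofList (c j)) lo R (js.map o) X = true)
    {bs : List Bool} (hbs : bs.length = lo) (hl : ∀ j ∈ js, (c j).length = lo)
    (hne : ∀ j ∈ js, (o j).val + signedSum (c j) bs ≠ 0)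
    (hprod : (js.map fun j => (o j).val + signedSum (c j) bs).prod = 1) :
    bitIndexFrom X bs ∈ R := by
  subst hbs
  obtain ⟨S, hS, hk⟩ := exists_of_nonvanishing h hl hne (by
    rw [Nat.testBit_two_pow_sub_one]
    simpa using bitIndex_lt bs)
  have := congrArg (fun n => n.testBit (bitIndex bs)) (Nat.eq_of_beq_eq_true hk)
  simp only [Nat.testBit_and, Nat.testBit_or, hS, Bool.true_and, Bool.or_eq_true] at this
  rw [bitIndexFrom_eq]
  rcases this with h1 | h1
  · rw [prod_eq_of_parity hl hne, h1] at hprod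
    exact absurd hprod (by decide)
  · exact mem_of_testBit_slice h1

/-- Passes the digitwise sum of two lists, with signs, to `k`. -/
def addSigned (b : Bool) : List Trit → List Trit → (List Trit → Bool) → Bool
  | o :: os, r :: rs, k =>
    addSigned b os rs fun l => (Trit.add o (Trit.signed b r)).force fun a => k (a :: l)
  | _, _, k => k []

theorem addSigned_map (b : Bool) (js : List κ) (o r : κ → Trit) (k : List Trit → Bool) :
    addSigned b (js.map o) (js.map r) k =
      k (js.map fun j => Trit.add (o j) (Trit.signed b (r j))) := by
  induction js generalizing k with
  | nil => rfl
  | cons j js ih => simp [addSigned, ih, Trit.force_eq]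

/-- Runs `checkLeaf` over all sign choices for the rows in a list. -/
def checkTree (ts : List TruthTable) (lo : ℕ) (R : List ℕ) :
    List (List Trit) → List Trit → ℕ → Bool
  | [], os, X => checkLeaf ts lo R os X
  | r :: rs, os, X =>
    addSigned false os r (fun os' => natForce (2 * X) (checkTree ts lo R rs os')) &&
      addSigned true os r (fun os' => natForce (2 * X + 1) (checkTree ts lo R rs os'))

theorem mem_of_checkTree {ι : Type} {js : List κ} {c : κ → List Trit} {lo : ℕ} {R : List ℕ}
    (G : ι → κ → Trit) (his : List ι) {o : κ → Trit} {X : ℕ}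
    (h : checkTree (js.map fun j => ofList (c j)) lo R (his.map fun i => js.map (G i))
      (js.map o) X = true)
    {as bs : List Bool} (has : as.length = his.length)
    (hbs : bs.length = lo) (hl : ∀ j ∈ js, (c j).length = lo)
    (hne : ∀ j ∈ js, (o j).val + signedSum (his.map (G · j) ++ c j) (as ++ bs) ≠ 0)
    (hprod : (js.map fun j => (o j).val +
      signedSum (his.map (G · j) ++ c j) (as ++ bs)).prod = 1) :
    bitIndexFrom X (as ++ bs) ∈ R := by
  induction his generalizing o X as with
  | nil =>
    obtain rfl : as = [] := by simpa using has
    exact mem_of_checkLeaf h hbs hl hne hprod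
  | cons i his ih =>
    cases as with
    | nil => simp at has
    | cons a as =>
      simp only [List.map_cons, checkTree, addSigned_map, natForce_eq, Bool.and_eq_true] at h
      have key : checkTree (js.map fun j => ofList (c j)) lo R (his.map fun i => js.map (G i))
          (js.map fun j => Trit.add (o j) (Trit.signed a (G i j))) (2 * X + a.toNat) = true := by
        cases a
        · exact h.1
        · exact h.2
      refine ih key (by simpa using has) ?_ ?_
      · simpa [signedSum, Trit.val_add, add_assoc] using hne
      · simpa [signedSum, Trit.val_add, add_assoc] using hprod

/-- Checks that all words without zeros and with product `1` in the span of `his ++ los`, where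
the coefficients are nonzero and given by a list of signs, come from signs with index in `R`. -/
def checkCode {ι : Type} (js : List κ) (G : ι → κ → Trit) (his los : List ι) (R : List ℕ) :
    Bool :=
  withOfLists (js.map fun j => los.map (G · j)) fun ts =>
    Trit.forceLists (his.map fun i => js.map (G i)) fun rs =>
      natForceList R fun R' => checkTree ts los.length R' rs (js.map fun _ => Trit.zero) 0

theorem mem_of_checkCode {ι : Type} {js : List κ} {G : ι → κ → Trit} {his los : List ι}
    {R : List ℕ} (h : checkCode js G his los R = true) {bs : List Bool}
    (hbs : bs.length = (his ++ los).length)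
    (hne : ∀ j ∈ js, signedSum ((his ++ los).map (G · j)) bs ≠ 0)
    (hprod : (js.map fun j => signedSum ((his ++ los).map (G · j)) bs).prod = 1) :
    bitIndex bs ∈ R := by
  rw [checkCode, withOfLists_eq, Trit.forceLists_eq, natForceList_eq, List.map_map] at h
  rw [List.length_append] at hbs
  rw [← List.take_append_drop his.length bs] at hne hprod ⊢
  refine mem_of_checkTree G his h (by simp; omega) (by simp; omega) (by simp) ?_ ?_
  · simpa [Trit.val] using hne
  · simpa [Trit.val] using hprod

end TruthTable

/-- The quadratic character modulo `q` of `a`, computed by Euler's criterion. -/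
def euler (q a : ℕ) : Trit :=
  match a ^ (q / 2) % q with
  | 0 => .zero
  | 1 => .pos
  | _ => .neg

/-- The matrix `U_q`, with `0` for the index `∞` and `a + 1` for the index `a ∈ GF(q)`. -/
def tritU (q : ℕ) : ℕ → ℕ → Trit
  | 0, 0 => .zero
  | 0, _ + 1 => .pos
  | _ + 1, 0 => .neg
  | a + 1, b + 1 => euler q (a + (q - b))

/-- The identity matrix. -/
def tritOne (i j : ℕ) : Trit :=
  match Nat.beq i j with
  | true => .pos
  | false => .zero

/-- The generator matrix `(I | U_q)`. -/
def tritGen (q i : ℕ) : ℕ ⊕ ℕ → Trit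
  | .inl j => tritOne i j
  | .inr j => tritU q i j

/-- The left half of the matrix `H` (for `b = true`, its upper block, for `b = false` its lower
block). -/
def tritH (q : ℕ) (b : Bool) (k l : ℕ) : Trit :=
  Trit.add (tritOne k l) (Trit.signed b (tritU q l k))

/-- Whether a digit is `-1`. -/
def Trit.isNeg : Trit → Bool
  | .neg => true
  | _ => false

/-- The indices of the sign patterns of the left halves of the rows of `H` and `-H`. -/
def rowIndices (q : ℕ) : List ℕ :=
  [(false, false), (false, true), (true, false), (true, true)].flatMap fun e =>
    (List.range (q + 1)).map fun k => bitIndex ((List.range (q + 1)).map fun l =>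
      (Trit.signed e.1 (tritH q e.2 k l)).isNeg)

/-- Checks that all words of `L(q)` without zeros and with product `1` agree on the left half with
rows of `H` or `-H`, splitting off `h` coordinates in the search. -/
def checkL (q h : ℕ) : Bool :=
  TruthTable.checkCode ((List.range (q + 1)).map Sum.inr ++ (List.range (q + 1)).map Sum.inl)
    (tritGen q) (List.range h) (List.range' h (q + 1 - h)) (rowIndices q)

theorem checkL_five : checkL 5 2 = true := by decide +kernel

theorem checkL_eleven : checkL 11 4 = true := by decide +kernel

theorem checkL_seventeen : checkL 17 4 = true := by decide +kernel

theorem checkL_twentythree : checkL 23 6 = true := by decide +kernel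

section Theory

variable {F : Type} [Field F] [Fintype F] [DecidableEq F]

/-- The matrix `U_q` modulo 3. -/
def Umod (F : Type) [Field F] [Fintype F] [DecidableEq F] (i j : Option F) : ZMod 3 :=
  ((Umat F i j : ℤ) : ZMod 3)

/-- The matrix `H` modulo 3. -/
def Hmod (F : Type) [Field F] [Fintype F] [DecidableEq F] (i j : Option F ⊕ Option F) : ZMod 3 :=
  ((Hmat F i j : ℤ) : ZMod 3)

theorem Umod_none_none : Umod F none none = 0 := by simp [Umod, Umat, Smat]

theorem Umod_none_some (b : F) : Umod F none (some b) = 1 := by simp [Umod, Umat, Smat]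

theorem Umod_some_none (a : F) : Umod F (some a) none = -1 := by simp [Umod, Umat]

theorem Umod_some_some (a b : F) :
    Umod F (some a) (some b) = ((quadraticChar F (a - b) : ℤ) : ZMod 3) := by
  simp [Umod, Umat, Smat]

theorem Umod_self (i : Option F) : Umod F i i = 0 := by
  cases i <;> simp [Umod_none_none, Umod_some_some]

theorem quadraticChar_cast_mul_self {a : F} (h : a ≠ 0) :
    ((quadraticChar F a : ℤ) : ZMod 3) * ((quadraticChar F a : ℤ) : ZMod 3) = 1 := by
  rcases quadraticChar_dichotomy h with h | h <;> simp [h]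

theorem Umod_mul_self {i j : Option F} (h : i ≠ j) : Umod F i j * Umod F i j = 1 := by
  cases i <;> cases j
  · exact absurd rfl h
  · simp [Umod_none_some]
  · simp [Umod_some_none]
  · rw [Umod_some_some]
    exact quadraticChar_cast_mul_self (sub_ne_zero.2 fun e => h (by rw [e]))

theorem sum_quadraticChar_sub (hF : ringChar F ≠ 2) (b : F) :
    ∑ a : F, quadraticChar F (a - b) = 0 := by
  rw [← quadraticChar_sum_zero hF]
  exact Fintype.sum_equiv (Equiv.subRight b) _ _ fun _ => rfl

theorem sum_quadraticChar_sub_mul_self (b : F) :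
    ∑ a : F, quadraticChar F (a - b) * quadraticChar F (a - b) = (Fintype.card F : ℤ) - 1 := by
  have h : ∀ a : F, quadraticChar F (a - b) * quadraticChar F (a - b) =
      1 - if a = b then 1 else 0 := by
    intro a
    split_ifs with h
    · simp [h]
    · rw [← sq, quadraticChar_sq_one (sub_ne_zero.2 h), sub_zero]
  simp [h, -quadraticChar_apply]

theorem sum_quadraticChar_sub_mul (hF : ringChar F ≠ 2) {b c : F} (hbc : b ≠ c) :
    ∑ a : F, quadraticChar F (a - b) * quadraticChar F (a - c) = -1 := by
  have hcb : c - b ≠ 0 := sub_ne_zero.2 hbc.symm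
  have h := jacobiSum_nontrivial_inv (quadraticChar_ne_one hF)
  rw [(quadraticChar_isQuadratic F).inv, jacobiSum] at h
  have h1 : ∑ a : F, quadraticChar F (a - b) * quadraticChar F (a - c) =
      ∑ x : F, quadraticChar F (-1) * (quadraticChar F x * quadraticChar F (1 - x)) := by
    refine (Fintype.sum_equiv ((Equiv.mulLeft₀ _ hcb).trans (Equiv.addRight b)) _ _ ?_).symm
    intro x
    have e1 : (c - b) * x + b - b = (c - b) * x := by ring
    have e2 : (c - b) * x + b - c = (c - b) * (-1 * (1 - x)) := by ring
    have e3 := quadraticChar_sq_one hcb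
    change _ = quadraticChar F ((c - b) * x + b - b) * quadraticChar F ((c - b) * x + b - c)
    rw [e1, e2, map_mul, map_mul, map_mul]
    linear_combination (-(quadraticChar F (-1)) * quadraticChar F x * quadraticChar F (1 - x)) * e3
  rw [h1, ← Finset.mul_sum, h]
  have := quadraticChar_sq_one (F := F) (a := -1) (by simp)
  linear_combination -this

theorem sum_Umod_mul_Umod (hF : ringChar F ≠ 2) (hq : Fintype.card F % 3 = 2)
    (k l : Option F) : ∑ i, Umod F i k * Umod F i l = if k = l then -1 else 0 := by
  have hc : (Fintype.card F : ZMod 3) = -1 := by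
    rw [← ZMod.natCast_mod, hq]
    rfl
  rw [Fintype.sum_option]
  cases k <;> cases l
  · simp [Umod_none_none, Umod_some_none, hc]
  · rename_i c
    have := congrArg (Int.cast : ℤ → ZMod 3) (sum_quadraticChar_sub hF c)
    push_cast at this
    simp [Umod_none_none, Umod_some_none, Umod_some_some, this, -quadraticChar_apply]
  · rename_i b
    have := congrArg (Int.cast : ℤ → ZMod 3) (sum_quadraticChar_sub hF b)
    push_cast at this
    simp [Umod_none_none, Umod_some_none, Umod_some_some, this, -quadraticChar_apply]
  · rename_i b c
    by_cases hbc : b = c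
    · subst hbc
      have := congrArg (Int.cast : ℤ → ZMod 3) (sum_quadraticChar_sub_mul_self b)
      push_cast at this
      simp [Umod_none_some, Umod_some_some, this, hc, -quadraticChar_apply]
    · have := congrArg (Int.cast : ℤ → ZMod 3) (sum_quadraticChar_sub_mul hF hbc)
      push_cast at this
      simp [Umod_none_some, Umod_some_some, this, hbc, -quadraticChar_apply]

theorem Hmod_inl_inl (i k : Option F) :
    Hmod F (.inl i) (.inl k) = (if i = k then 1 else 0) - Umod F k i := by
  simp [Hmod, Hmat, Umod, Matrix.one_apply]

theorem Hmod_inl_inr (i k : Option F) :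
    Hmod F (.inl i) (.inr k) = Umod F i k + (if i = k then 1 else 0) := by
  simp [Hmod, Hmat, Umod, Matrix.one_apply]

theorem Hmod_inr_inl (i k : Option F) :
    Hmod F (.inr i) (.inl k) = (if i = k then 1 else 0) + Umod F k i := by
  simp [Hmod, Hmat, Umod, Matrix.one_apply]

theorem Hmod_inr_inr (i k : Option F) :
    Hmod F (.inr i) (.inr k) = Umod F i k - (if i = k then 1 else 0) := by
  simp [Hmod, Hmat, Umod, Matrix.one_apply]

theorem mem_Lcode_iff (x : Option F ⊕ Option F → ZMod 3) :
    x ∈ Lcode F ↔ ∀ k, x (.inr k) = ∑ i, x (.inl i) * Umod F i k := by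
  constructor
  · intro hx
    induction hx using Submodule.span_induction with
    | mem y hy =>
      obtain ⟨i, rfl⟩ := hy
      simp [genRowL, Umod]
    | zero => simp
    | add y z _ _ hy hz => simp [hy, hz, add_mul, Finset.sum_add_distrib]
    | smul a y _ hy =>
      intro k
      simp only [Pi.smul_apply, smul_eq_mul, hy, Finset.mul_sum, mul_assoc]
  · intro h
    have : x = ∑ i, x (.inl i) • genRowL F i := by
      funext j
      cases j with
      | inl k => simp [genRowL, Finset.sum_apply]
      | inr k => simp [genRowL, Finset.sum_apply, h k, Umod]
    rw [this]
    exact Submodule.sum_mem _ fun i _ =>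
      Submodule.smul_mem _ _ (Submodule.subset_span (Set.mem_range_self i))

theorem Hmod_mem_Lcode (hF : ringChar F ≠ 2) (hq : Fintype.card F % 3 = 2)
    (i : Option F ⊕ Option F) : Hmod F i ∈ Lcode F := by
  rw [mem_Lcode_iff]
  intro k
  have h := sum_Umod_mul_Umod hF hq
  cases i with
  | inl i =>
    simp only [Hmod_inl_inl, Hmod_inl_inr, sub_mul, Finset.sum_sub_distrib, h]
    split_ifs <;> simp
  | inr i =>
    simp only [Hmod_inr_inl, Hmod_inr_inr, add_mul, Finset.sum_add_distrib, h]
    split_ifs <;> simp [sub_eq_add_neg]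

theorem Hmod_none (j : Option F ⊕ Option F) : Hmod F (.inl none) j = 1 := by
  rcases j with (_ | k) | (_ | k) <;>
    simp [Hmod_inl_inl, Hmod_inl_inr, Umod_none_none, Umod_none_some, Umod_some_none]

theorem Hmod_ne_zero (i j : Option F ⊕ Option F) : Hmod F i j ≠ 0 := by
  have key : ∀ u : ZMod 3, u * u = 1 → u ≠ 0 := by decide
  rcases i with i | i <;> rcases j with j | j
  all_goals
    by_cases h : i = j
    · subst h
      simp [Hmod_inl_inl, Hmod_inl_inr, Hmod_inr_inl, Hmod_inr_inr, Umod_self]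
    · simpa [Hmod_inl_inl, Hmod_inl_inr, Hmod_inr_inl, Hmod_inr_inr, h] using
        key _ (Umod_mul_self (by tauto))

theorem exists_Hmod_ne {i : Option F ⊕ Option F} (hi : i ≠ .inl none) :
    ∃ j k, Hmod F i j ≠ Hmod F i k := by
  rcases i with (_ | i) | i
  · exact absurd rfl hi
  · refine ⟨.inl (some i), .inl none, ?_⟩
    simp [Hmod_inl_inl, Umod_self, Umod_none_some]
    decide
  · refine ⟨.inl i, .inr i, ?_⟩
    simp [Hmod_inr_inl, Hmod_inr_inr, Umod_self]
    decide

theorem prod_Hmod (hF : ringChar F ≠ 2) (i : Option F ⊕ Option F) : ∏ j, Hmod F i j = 1 := by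
  have hodd : Odd (Fintype.card F) := Nat.odd_iff.2 (FiniteField.odd_card_of_char_ne_two hF)
  obtain ⟨n, hn⟩ := hodd
  have hmul : ∀ a b : F, Umod F (some b) (some a) * Umod F (some a) (some b) =
      if b = a then 0 else ((quadraticChar F (-1) : ℤ) : ZMod 3) := by
    intro a b
    split_ifs with h
    · simp [h, Umod_self]
    · have h1 : a - b = -1 * (b - a) := by ring
      rw [Umod_some_some, Umod_some_some, h1, map_mul, Int.cast_mul, mul_left_comm,
        quadraticChar_cast_mul_self (sub_ne_zero.2 h), mul_one]
  have hprod : ∀ (a : F) (c d : ZMod 3), d * d = 1 → ∏ b : F, (if b = a then c else d) = c := by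
    intro a c d hd
    rw [Finset.prod_ite]
    simp [Finset.filter_eq', Finset.filter_ne', hn, pow_mul, sq, hd]
  have hχ := quadraticChar_cast_mul_self (F := F) (a := -1) (by simp)
  rw [Fintype.prod_sum_type, ← Finset.prod_mul_distrib, Fintype.prod_option]
  rcases i with (_ | a) | (_ | a)
  · simp [Hmod_none]
  · have h1 : ∀ b, Hmod F (.inl (some a)) (.inl (some b)) * Hmod F (.inl (some a)) (.inr (some b)) =
        if b = a then 1 else -((quadraticChar F (-1) : ℤ) : ZMod 3) := by
      intro b
      have := hmul a b
      rw [Hmod_inl_inl, Hmod_inl_inr]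
      split_ifs at this ⊢ <;> simp_all [Umod_self, -quadraticChar_apply]
    rw [Finset.prod_congr rfl fun b _ => h1 b, hprod _ _ _ (by simpa using hχ)]
    simp [Hmod_inl_inl, Hmod_inl_inr, Umod_none_some, Umod_some_none]
  · simp [Hmod_inr_inl, Hmod_inr_inr, Umod_none_none, Umod_none_some, Umod_some_none, hn,
      pow_succ, pow_mul]
  · have h1 : ∀ b, Hmod F (.inr (some a)) (.inl (some b)) * Hmod F (.inr (some a)) (.inr (some b)) =
        if b = a then -1 else ((quadraticChar F (-1) : ℤ) : ZMod 3) := by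
      intro b
      have := hmul a b
      rw [Hmod_inr_inl, Hmod_inr_inr]
      split_ifs at this ⊢ <;> simp_all [Umod_self, -quadraticChar_apply]
    rw [Finset.prod_congr rfl fun b _ => h1 b, hprod _ _ _ hχ]
    simp [Hmod_inr_inl, Hmod_inr_inr, Umod_none_some, Umod_some_none]

end Theory

theorem signedSum_map {ι : Type*} (is : List ι) (u : ι → Trit) (b : ι → Bool) :
    signedSum (is.map u) (is.map b) = (is.map fun i => (Trit.signed (b i) (u i)).val).sum := by
  induction is with
  | nil => rfl
  | cons i is ih => simp [signedSum, ih]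

theorem List.prod_map_range {M : Type*} [CommMonoid M] (g : ℕ → M) (n : ℕ) :
    ((List.range n).map g).prod = ∏ i ∈ Finset.range n, g i := by
  induction n with
  | zero => rfl
  | succ n ih => simp [List.range_succ, Finset.prod_range_succ, ih]

theorem List.sum_map_range {M : Type*} [AddCommMonoid M] (g : ℕ → M) (n : ℕ) :
    ((List.range n).map g).sum = ∑ i ∈ Finset.range n, g i := by
  induction n with
  | zero => rfl
  | succ n ih => simp [List.range_succ, Finset.sum_range_succ, ih]

/-- The element of `GF(q) ∪ {∞}` with a given number: `0` for `∞` and `a + 1` for `a ∈ GF(q)`. -/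
def label (F : Type) [Field F] : ℕ → Option F
  | 0 => none
  | a + 1 => some (a : F)

theorem label_injOn {F : Type} [Field F] {q : ℕ} [CharP F q] :
    Set.InjOn (label F) (Finset.range (q + 1)) := by
  intro i hi j hj h
  simp only [Finset.coe_range, Set.mem_Iio] at hi hj
  cases i <;> cases j
  · rfl
  · simp [label] at h
  · simp [label] at h
  · rw [CharP.natCast_injOn_Iio F q (Set.mem_Iio.2 (by omega)) (Set.mem_Iio.2 (by omega))
      (Option.some_injective _ h)]

theorem val_tritOne {F : Type} [Field F] [DecidableEq F] {q : ℕ} [CharP F q] {i j : ℕ}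
    (hi : i < q + 1) (hj : j < q + 1) :
    (tritOne i j).val = if label F i = label F j then 1 else 0 := by
  have h : label F i = label F j ↔ i = j :=
    label_injOn.eq_iff (by simpa using hi) (by simpa using hj)
  simp only [h, tritOne]
  split <;> rename_i e
  · rw [if_pos (Nat.eq_of_beq_eq_true e)]; rfl
  · rw [if_neg (Nat.ne_of_beq_eq_false e)]; rfl

section Transport

variable {F : Type} [Field F] [Fintype F] [DecidableEq F] {q : ℕ}

theorem image_label [CharP F q] (hq : Fintype.card F = q) :
    (Finset.range (q + 1)).image (label F) = Finset.univ := by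
  rw [← Finset.card_eq_iff_eq_univ, Finset.card_image_of_injOn label_injOn]
  simp [hq]

theorem prod_label [CharP F q] (hq : Fintype.card F = q) {M : Type*} [CommMonoid M]
    (g : Option F → M) : ∏ i ∈ Finset.range (q + 1), g (label F i) = ∏ i, g i := by
  rw [← image_label hq, Finset.prod_image label_injOn]

theorem sum_label [CharP F q] (hq : Fintype.card F = q) {M : Type*} [AddCommMonoid M]
    (g : Option F → M) : ∑ i ∈ Finset.range (q + 1), g (label F i) = ∑ i, g i := by
  rw [← image_label hq, Finset.sum_image label_injOn]

theorem exists_label [CharP F q] (hq : Fintype.card F = q) (i : Option F) :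
    ∃ k < q + 1, label F k = i := by
  have := Finset.mem_univ i
  rw [← image_label hq] at this
  simpa using this

theorem val_euler [CharP F q] (hq : Fintype.card F = q) (hF : ringChar F ≠ 2) (m : ℕ) :
    (euler q m).val = ((quadraticChar F (m : F) : ℤ) : ZMod 3) := by
  have h := quadraticChar_eq_pow_of_char_ne_two' hF (m : F)
  have hq0 : 1 < q := hq ▸ Fintype.one_lt_card
  rw [hq, ← Nat.cast_pow, CharP.cast_eq_mod F q (m ^ _)] at h
  have hr := Nat.mod_lt (m ^ (q / 2)) (by omega : 0 < q)
  unfold euler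
  generalize m ^ (q / 2) % q = r at h hr
  have hinj := CharP.natCast_injOn_Iio F q (Set.mem_Iio.2 hr)
  have h1 : (-1 : F) ≠ 1 := Ring.neg_one_ne_one_of_char_ne_two hF
  rcases quadraticChar_isQuadratic F (m : F) with e | e | e <;> rw [e] at h ⊢
  · obtain rfl : r = 0 := hinj (Set.mem_Iio.2 (by omega)) (by simpa using h.symm)
    rfl
  · obtain rfl : r = 1 := hinj (Set.mem_Iio.2 (by omega)) (by simpa using h.symm)
    rfl
  · split
    · simp at h
    · simp at h; exact absurd h h1
    · rfl

theorem val_tritU [CharP F q] (hq : Fintype.card F = q) (hF : ringChar F ≠ 2) (i : ℕ) {j : ℕ}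
    (hj : j < q + 1) : (tritU q i j).val = Umod F (label F i) (label F j) := by
  rcases i with _ | a <;> rcases j with _ | b
  · rw [label, Umod_none_none]; rfl
  · rw [label, label, Umod_none_some]; rfl
  · rw [label, label, Umod_some_none]; rfl
  · rw [label, label, Umod_some_some, tritU, val_euler hq hF, Nat.cast_add,
      Nat.cast_sub (by omega), CharP.cast_eq_zero F q, zero_sub, sub_eq_add_neg]

theorem val_signed (b : Bool) (u : Trit) :
    (Trit.signed b u).val = (if b then -1 else 1) * u.val := by
  cases b <;> simp [Trit.signed, Trit.val_opp]

theorem val_tritH [CharP F q] (hq : Fintype.card F = q) (hF : ringChar F ≠ 2) (b : Bool) {k l : ℕ}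
    (hk : k < q + 1) (hl : l < q + 1) :
    (tritH q b k l).val =
      Hmod F (if b then .inl (label F k) else .inr (label F k)) (.inl (label F l)) := by
  rw [tritH, Trit.val_add, val_tritOne (F := F) hk hl, val_signed, val_tritU hq hF _ hk]
  cases b
  · simp [Hmod_inr_inl]
  · simp [Hmod_inl_inl, sub_eq_add_neg]

theorem isNeg_eq (u : Trit) : u.isNeg = decide (u.val = -1) := by
  cases u <;> decide

/-- The words of `L(q)` without zeros and with product `1` are the rows of `H` and `-H`. -/
theorem exists_eq_Hmod [CharP F q] (hq : Fintype.card F = q) (hF : ringChar F ≠ 2)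
    (hq3 : q % 3 = 2) {h : ℕ} (hh : h ≤ q + 1) (hc : checkL q h = true)
    {x : Option F ⊕ Option F → ZMod 3} (hx : x ∈ Lcode F) (hne : ∀ j, x j ≠ 0)
    (hprod : ∏ j, x j = 1) :
    ∃ (s : Bool) (i : Option F ⊕ Option F), ∀ j, x j = (if s then 1 else -1) * Hmod F i j := by
  have hL := (mem_Lcode_iff x).1 hx
  set b : ℕ → Bool := fun i => decide (x (.inl (label F i)) = -1) with hb
  have hrange : List.range h ++ List.range' h (q + 1 - h) = List.range (q + 1) := by
    rw [List.range_eq_range', List.range_eq_range']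
    simpa [hh] using List.range'_append_1 (s := 0) (m := h) (n := q + 1 - h)
  have hval : ∀ i (u : Trit), (Trit.signed (b i) u).val = x (.inl (label F i)) * u.val := by
    intro i u
    rw [val_signed]
    have key : ∀ y : ZMod 3, y ≠ 0 → (if decide (y = -1) = true then -1 else 1) = y := by decide
    rw [key _ (hne _)]
  have hinr : ∀ j < q + 1, signedSum ((List.range (q + 1)).map (tritGen q · (.inr j)))
      ((List.range (q + 1)).map b) = x (.inr (label F j)) := by
    intro j hj
    rw [signedSum_map, List.sum_map_range, hL, ← sum_label hq]
    exact Finset.sum_congr rfl fun i _ => by rw [hval, tritGen, val_tritU hq hF _ hj]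
  have hinl : ∀ j < q + 1, signedSum ((List.range (q + 1)).map (tritGen q · (.inl j)))
      ((List.range (q + 1)).map b) = x (.inl (label F j)) := by
    intro j hj
    rw [signedSum_map, List.sum_map_range]
    calc _ = ∑ i ∈ Finset.range (q + 1),
          x (.inl (label F i)) * (if label F i = label F j then 1 else 0) :=
          Finset.sum_congr rfl fun i hi => by
            rw [hval, tritGen, val_tritOne (F := F) (Finset.mem_range.1 hi) hj]
      _ = _ := by
        rw [sum_label hq fun i => x (.inl i) * (if i = label F j then 1 else 0)]
        simp [-Fintype.sum_option]
  have hmem : bitIndex ((List.range (q + 1)).map b) ∈ rowIndices q := by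
    refine TruthTable.mem_of_checkCode hc (by simp [hrange]) ?_ ?_
    · intro j hj
      rw [hrange]
      rcases j with j | j <;> simp at hj
      · rw [hinl j (by omega)]; exact hne _
      · rw [hinr j (by omega)]; exact hne _
    · rw [hrange, List.map_append, List.prod_append, List.map_map, List.map_map,
        List.prod_map_range, List.prod_map_range, ← hprod, Fintype.prod_sum_type, mul_comm,
        ← prod_label hq, ← prod_label hq fun j => x (.inr j)]
      congr 1
      · exact Finset.prod_congr rfl fun j hj => hinl j (Finset.mem_range.1 hj)
      · exact Finset.prod_congr rfl fun j hj => hinr j (Finset.mem_range.1 hj)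
  obtain ⟨e, -, hmem⟩ := List.mem_flatMap.1 hmem
  obtain ⟨k, hk, hmem⟩ := List.mem_map.1 hmem
  have hk := List.mem_range.1 hk
  have hbits := List.map_inj_left.1 (bitIndex_injective (by simp) hmem)
  have hleft : ∀ i, x (.inl i) = (if !e.1 then 1 else -1) *
      Hmod F (if e.2 then .inl (label F k) else .inr (label F k)) (.inl i) := by
    intro i
    obtain ⟨l, hl, rfl⟩ := exists_label hq i
    have h1 := hbits l (List.mem_range.2 hl)
    rw [isNeg_eq, val_signed, val_tritH hq hF _ hk hl, hb] at h1
    have key : ∀ (s : Bool) (y z : ZMod 3), y ≠ 0 → z ≠ 0 →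
      decide ((if s then -1 else 1) * z = -1) = decide (y = -1) →
      y = (if !s then 1 else -1) * z := by decide
    exact key _ _ _ (hne _) (Hmod_ne_zero _ _) h1
  refine ⟨!e.1, if e.2 then .inl (label F k) else .inr (label F k), ?_⟩
  rintro (j | j)
  · exact hleft j
  · rw [hL, (mem_Lcode_iff _).1 (Hmod_mem_Lcode hF (hq ▸ hq3) _), Finset.mul_sum]
    exact Finset.sum_congr rfl fun i _ => by rw [hleft, mul_assoc]

end Transport

theorem comp_symm_mem {ι K : Type*} [Finite ι] [Semiring K] {C : Submodule K (ι → K)}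
    {σ : Equiv.Perm ι}
    (h : ∀ c ∈ C, (fun j => c (σ j)) ∈ C) (c : ι → K) (hc : c ∈ C) :
    (fun j => c (σ.symm j)) ∈ C := by
  have hpow : ∀ n : ℕ, (fun j => c ((σ ^ n) j)) ∈ C := by
    intro n
    induction n with
    | zero => simpa using hc
    | succ n ih => simpa [pow_succ] using h _ ih
  have hinv : σ ^ (orderOf σ - 1) = σ.symm := by
    refine eq_inv_of_mul_eq_one_left ?_
    rw [← pow_succ, Nat.sub_add_cancel (orderOf_pos σ), pow_orderOf_eq_one]
  simpa [hinv] using hpow (orderOf σ - 1)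

section Design

variable {F : Type} [Field F] [Fintype F] [DecidableEq F]

theorem dvec_apply (s : Bool) (i j : Option F ⊕ Option F) :
    dvec F s i j = (if s then 1 else -1) * Hmod F i j + 2 := rfl

theorem dvec_mem_Lcode (hF : ringChar F ≠ 2) (hq : Fintype.card F % 3 = 2)
    (s : Bool) (i : Option F ⊕ Option F) : dvec F s i ∈ Lcode F := by
  have h : dvec F s i = (if s then (1 : ZMod 3) else -1) • Hmod F i +
      (2 : ZMod 3) • Hmod F (.inl none) := by
    funext j
    simp only [Pi.add_apply, Pi.smul_apply, smul_eq_mul, Hmod_none, mul_one, dvec_apply]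
  rw [h]
  exact Submodule.add_mem _ (Submodule.smul_mem _ _ (Hmod_mem_Lcode hF hq _))
    (Submodule.smul_mem _ _ (Hmod_mem_Lcode hF hq _))

theorem dvec_eq_ite (s : Bool) (i j : Option F ⊕ Option F) :
    dvec F s i j = if dvec F s i j ≠ 0 then 1 else 0 := by
  have key : ∀ (s : Bool) (y : ZMod 3), y ≠ 0 → (if s then 1 else -1) * y + 2 =
    if (if s then 1 else -1) * y + 2 ≠ 0 then 1 else 0 := by decide
  exact key s _ (Hmod_ne_zero i j)

/-- The vectors `dvec F s i`, for `i` different from the index of the all-one row, span `L(q)`. -/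
theorem Lcode_le_of_dvec_mem {M : Submodule (ZMod 3) (Option F ⊕ Option F → ZMod 3)}
    (hM : ∀ s i, i ≠ .inl none → dvec F s i ∈ M) : Lcode F ≤ M := by
  have hone : (fun _ => 1) ∈ M := by
    have h : (fun _ => 1) = dvec F true (.inr none) + dvec F false (.inr none) := by
      funext j
      simp only [Pi.add_apply, dvec_apply]
      generalize Hmod F (.inr none) j = y
      revert y
      decide
    rw [h]
    exact M.add_mem (hM _ _ (by simp)) (hM _ _ (by simp))
  have hH : ∀ i, Hmod F i ∈ M := by
    intro i
    by_cases hi : i = .inl none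
    · rw [hi, funext Hmod_none]
      exact hone
    · have h : Hmod F i = dvec F true i + fun _ => 1 := by
        funext j
        simp only [Pi.add_apply, dvec_apply]
        generalize Hmod F i j = y
        revert y
        decide
      rw [h]
      exact M.add_mem (hM _ _ hi) hone
  rw [Lcode, Submodule.span_le]
  rintro _ ⟨i, rfl⟩
  have h : genRowL F i = -(Hmod F (.inl i) + Hmod F (.inr i)) := by
    have key : ∀ d u : ZMod 3, d = -(d - u + (d + u)) ∧ u = -(u + d + (u - d)) := by decide
    funext j
    rcases j with k | k
    · rw [Pi.neg_apply, Pi.add_apply, Hmod_inl_inl, Hmod_inr_inl]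
      exact (key _ _).1
    · rw [Pi.neg_apply, Pi.add_apply, Hmod_inl_inr, Hmod_inr_inr]
      exact (key _ _).2
  rw [SetLike.mem_coe, h]
  exact M.neg_mem (M.add_mem (hH _) (hH _))

theorem image_support_dvec (σ : Equiv.Perm (Option F ⊕ Option F)) (s s' : Bool)
    (i i' : Option F ⊕ Option F) :
    σ '' {j | dvec F s i j ≠ 0} = {j | dvec F s' i' j ≠ 0} ↔
      (fun j => dvec F s i (σ.symm j)) = dvec F s' i' := by
  rw [Equiv.image_eq_preimage_symm, Set.ext_iff, funext_iff]
  refine forall_congr' fun j => ⟨fun h => ?_, fun h => ?_⟩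
  · have h : dvec F s i (σ.symm j) ≠ 0 ↔ dvec F s' i' j ≠ 0 := h
    rw [dvec_eq_ite, dvec_eq_ite s' i' j]
    simp only [h]
  · simp only [Set.mem_preimage, Set.mem_ofPred_eq, h]

end Design

/-- (Corollary 1) For `q ∈ {5, 11, 17, 23}`, a permutation `σ` of the `2q+2` coordinate
positions maps `L(q)` onto itself if and only if `σ` maps every block of the Hadamard
3-design `D(q)` (the supports of the vectors `r + 2·1̄`, `r` ranging over the rows of `H`
and `−H` other than the all-one row and its negative) onto a block of `D(q)`. -/
theorem stmt_8 (q : ℕ) (hq : q = 5 ∨ q = 11 ∨ q = 17 ∨ q = 23)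
    (F : Type) [Field F] [Fintype F] [DecidableEq F] (hF : Fintype.card F = q)
    (σ : Equiv.Perm (Option F ⊕ Option F)) :
    (∀ c ∈ Lcode F, (fun j => c (σ j)) ∈ Lcode F) ↔
    (∀ (s : Bool) (i : Option F ⊕ Option F), i ≠ Sum.inl none →
      ∃ (s' : Bool) (i' : Option F ⊕ Option F), i' ≠ Sum.inl none ∧
        (⇑σ) '' {j | dvec F s i j ≠ 0} = {j | dvec F s' i' j ≠ 0}) := by
  have hprime : q.Prime := by rcases hq with rfl | rfl | rfl | rfl <;> norm_num
  have hq3 : q % 3 = 2 := by rcases hq with rfl | rfl | rfl | rfl <;> rfl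
  have hcheck : ∃ h ≤ q + 1, checkL q h = true := by
    rcases hq with rfl | rfl | rfl | rfl
    · exact ⟨2, by norm_num, checkL_five⟩
    · exact ⟨4, by norm_num, checkL_eleven⟩
    · exact ⟨4, by norm_num, checkL_seventeen⟩
    · exact ⟨6, by norm_num, checkL_twentythree⟩
  obtain ⟨h, hh, hcheck⟩ := hcheck
  have : Fact q.Prime := ⟨hprime⟩
  have : CharP F q := charP_of_card_eq_prime hF
  have hchar : ringChar F ≠ 2 := by
    rw [ringChar.eq F q]
    rcases hq with rfl | rfl | rfl | rfl <;> norm_num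
  constructor
  · intro hσ s i hi
    have hsgn : (if s then (1 : ZMod 3) else -1) ≠ 0 ∧
        (if s then (1 : ZMod 3) else -1) ^ 2 = 1 := by cases s <;> decide
    generalize ha : (if s then (1 : ZMod 3) else -1) = a at hsgn
    have hmem : (fun j => (a • Hmod F i) (σ.symm j)) ∈ Lcode F :=
      comp_symm_mem hσ _
        (Submodule.smul_mem _ a (Hmod_mem_Lcode hchar (hF ▸ hq3) i))
    have hprod : ∏ j, (a • Hmod F i) (σ.symm j) = 1 := by
      rw [Equiv.prod_comp σ.symm (a • Hmod F i)]
      simp only [Pi.smul_apply, smul_eq_mul, Finset.prod_mul_distrib, prod_Hmod hchar]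
      rw [Finset.prod_const, Finset.card_univ, Fintype.card_sum, ← two_mul, pow_mul, hsgn.2,
        one_pow, mul_one]
    obtain ⟨s', i', hx⟩ := exists_eq_Hmod hF hchar hq3 hh hcheck hmem
      (fun j => mul_ne_zero hsgn.1 (Hmod_ne_zero _ _)) hprod
    refine ⟨s', i', ?_, (image_support_dvec σ s s' i i').2 (funext fun j => ?_)⟩
    · rintro rfl
      obtain ⟨j, k, hjk⟩ := exists_Hmod_ne hi
      refine hjk (mul_left_cancel₀ hsgn.1 ?_)
      have h1 := (hx (σ j)).trans ((congrArg _ ((Hmod_none _).trans (Hmod_none (σ k)).symm)).trans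
        (hx (σ k)).symm)
      rwa [σ.symm_apply_apply, σ.symm_apply_apply] at h1
    · rw [dvec_apply, dvec_apply, ← hx, ha]
      rfl
  · intro hσ c hc
    have hle : Lcode F ≤ (Lcode F).comap (LinearMap.funLeft (ZMod 3) (ZMod 3) σ.symm) := by
      refine Lcode_le_of_dvec_mem fun s i hi => ?_
      obtain ⟨s', i', -, h⟩ := hσ s i hi
      rw [image_support_dvec] at h
      change (fun j => dvec F s i (σ.symm j)) ∈ Lcode F
      rw [h]
      exact dvec_mem_Lcode hchar (hF ▸ hq3) s' i'
    exact comp_symm_mem (σ := σ.symm) hle c hc
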